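/- Fix an integer L ≥ 1, a start x₀ ∈ {0,…,L}, and a horizon n with n ≥ 4L². For ω ∈ {0,1}^n let X_ω be the reflected simple random walk on {0,…,L} driven by ω and started at x₀. Then the probability, over ω chosen uniformly from {0,1}^n, that there exist t ≤ n and s ≤ n with X_ω(t) = 0 and X_ω(s) = L is at least 1/2. (This is the quantitative statement underlying the claim that after time Θ(T² + r²) a random walk on a line of length 2T + 2r + 2 has hit both the leftmost and rightmost nodes with probability at least 1/2, which guarantees the Monte Carlo sampler's next output is independent of the previous one.) -/

import Mathlib

open scoped Classical

/-- One step of the reflected simple random walk on `{0,…,L}`: from `0` move to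
`1`, from `L` move to `L−1`, and otherwise move up if the coin is `true` and
down if it is `false`. -/
def reflStep (L x : ℕ) (coin : Bool) : ℕ :=
  if x = 0 then 1 else if x = L then L - 1 else if coin then x + 1 else x - 1

/-- The reflected simple random walk on `{0,…,L}` started at `x₀` and driven by
the coin sequence `ω`. -/
def reflWalk (L x₀ : ℕ) (ω : ℕ → Bool) : ℕ → ℕ
  | 0 => x₀
  | t + 1 => reflStep L (reflWalk L x₀ ω t) (ω t)

/-- Extension of a finite coin sequence by `false`. -/
def extendCoins {n : ℕ} (ω : Fin n → Bool) : ℕ → Bool :=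
  fun s => if h : s < n then ω ⟨s, h⟩ else false

/-- The coin sequence that starts with `b` and continues with `ω`. -/
def consCoin (b : Bool) (ω : ℕ → Bool) : ℕ → Bool
  | 0 => b
  | s + 1 => ω s

/-- The number of coin sequences of length `n` whose extension satisfies `Q`. -/
noncomputable def coinCount (n : ℕ) (Q : (ℕ → Bool) → Prop) : ℕ :=
  (Finset.univ.filter fun ω : Fin n → Bool => Q (extendCoins ω)).card

/-- The reflected walk started at `x` visits `y` within `n` steps. -/
def Visits (L n x y : ℕ) (ω : ℕ → Bool) : Prop :=
  ∃ t ≤ n, reflWalk L x ω t = y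

theorem extendCoins_cons {n : ℕ} (b : Bool) (ω : Fin n → Bool) :
    extendCoins (Fin.cons b ω : Fin (n + 1) → Bool) = consCoin b (extendCoins ω) := by
  funext s
  cases s with
  | zero => simp [extendCoins, consCoin]
  | succ s =>
    by_cases h : s < n
    · simp only [extendCoins, consCoin, h, Nat.succ_lt_succ_iff, dif_pos]
      exact Fin.cons_succ (α := fun _ => Bool) b ω ⟨s, h⟩
    · simp [extendCoins, consCoin, h]

theorem coinCount_le (n : ℕ) (Q : (ℕ → Bool) → Prop) : coinCount n Q ≤ 2 ^ n := by
  simpa [coinCount] using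
    Finset.card_le_univ (Finset.univ.filter fun ω : Fin n → Bool => Q (extendCoins ω))

theorem coinCount_add_not (n : ℕ) (Q : (ℕ → Bool) → Prop) :
    coinCount n Q + coinCount n (fun ω => ¬ Q ω) = 2 ^ n := by
  simpa [coinCount] using Finset.card_filter_add_card_filter_not
    (s := (Finset.univ : Finset (Fin n → Bool))) (fun ω => Q (extendCoins ω))

theorem coinCount_succ (n : ℕ) (Q : (ℕ → Bool) → Prop) :
    coinCount (n + 1) Q =
      coinCount n (fun ω => Q (consCoin true ω)) +
        coinCount n (fun ω => Q (consCoin false ω)) := by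
  simp only [coinCount, Finset.card_filter]
  rw [← (Fin.consEquiv fun _ => Bool).sum_comp, Fintype.sum_prod_type, Fintype.sum_bool]
  simp [Fin.consEquiv, extendCoins_cons]

/-- One step of the drift argument: potentials `a`, `b` after the step and `c` before it. -/
theorem coinCount_drift {n : ℕ} {Q : (ℕ → Bool) → Prop} {a b c : ℤ}
    (ha : n * (coinCount n fun ω => Q (consCoin true ω) : ℤ) ≤ a * 2 ^ n)
    (hb : n * (coinCount n fun ω => Q (consCoin false ω) : ℤ) ≤ b * 2 ^ n)
    (h : a + b + 2 ≤ 2 * c) :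
    ((n + 1 : ℕ) : ℤ) * coinCount (n + 1) Q ≤ c * 2 ^ (n + 1) := by
  have h₁ : (coinCount (n + 1) Q : ℤ) ≤ 2 ^ (n + 1) := mod_cast coinCount_le (n + 1) Q
  have h₂ := mul_le_mul_of_nonneg_right h (by positivity : (0 : ℤ) ≤ 2 ^ n)
  rw [coinCount_succ] at h₁ ⊢
  push_cast at h₁ ⊢
  rw [pow_succ] at h₁ ⊢
  linarith

theorem reflWalk_consCoin (L x : ℕ) (b : Bool) (ω : ℕ → Bool) (t : ℕ) :
    reflWalk L x (consCoin b ω) (t + 1) = reflWalk L (reflStep L x b) ω t := by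
  induction t with
  | zero => rfl
  | succ t ih => rw [reflWalk, ih]; rfl

theorem visits_consCoin (L n x y : ℕ) (b : Bool) (ω : ℕ → Bool) :
    Visits L (n + 1) x y (consCoin b ω) ↔ x = y ∨ Visits L n (reflStep L x b) y ω := by
  constructor
  · rintro ⟨t, ht, h⟩
    cases t with
    | zero => exact Or.inl h
    | succ t => exact Or.inr ⟨t, by omega, by rwa [reflWalk_consCoin] at h⟩
  · rintro (h | ⟨t, ht, h⟩)
    · exact ⟨0, by omega, h⟩
    · exact ⟨t + 1, by omega, by rwa [reflWalk_consCoin]⟩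

theorem visits_self (L n x : ℕ) (ω : ℕ → Bool) : Visits L n x x ω :=
  ⟨0, n.zero_le, rfl⟩

theorem reflStep_zero (L : ℕ) (b : Bool) : reflStep L 0 b = 1 := by
  simp [reflStep]

theorem reflStep_self {L : ℕ} (hL : 1 ≤ L) (b : Bool) : reflStep L L b = L - 1 := by
  simp [reflStep, Nat.one_le_iff_ne_zero.mp hL]

theorem reflStep_true {L x : ℕ} (h0 : x ≠ 0) (h : x ≠ L) : reflStep L x true = x + 1 := by
  simp [reflStep, h0, h]

theorem reflStep_false {L x : ℕ} (h0 : x ≠ 0) (h : x ≠ L) : reflStep L x false = x - 1 := by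
  simp [reflStep, h0, h]

theorem mul_coinCount_not_visits_top {L : ℕ} (hL : 1 ≤ L) (n x : ℕ) (hx : x ≤ L) :
    n * (coinCount n fun ω => ¬ Visits L n x L ω : ℤ) ≤ ((L : ℤ) ^ 2 - x ^ 2) * 2 ^ n := by
  induction n generalizing x with
  | zero =>
    have : (x : ℤ) ^ 2 ≤ (L : ℤ) ^ 2 := by gcongr
    simpa using this
  | succ n ih =>
    rcases eq_or_ne x L with rfl | hxL
    · simp [visits_self, coinCount]
    rcases eq_or_ne x 0 with rfl | hx0
    · refine coinCount_drift (a := (L : ℤ) ^ 2 - 1) (b := (L : ℤ) ^ 2 - 1) ?_ ?_ (by simp; linarith)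
      all_goals
        simp only [visits_consCoin, hxL, false_or, reflStep_zero]
        simpa using ih 1 hL
    · refine coinCount_drift (a := (L : ℤ) ^ 2 - (x + 1) ^ 2) (b := (L : ℤ) ^ 2 - (x - 1) ^ 2)
        ?_ ?_ (by linarith)
      · simp only [visits_consCoin, hxL, false_or, reflStep_true hx0 hxL]
        simpa using ih (x + 1) (by omega)
      · simp only [visits_consCoin, hxL, false_or, reflStep_false hx0 hxL]
        simpa [Nat.cast_pred (Nat.pos_of_ne_zero hx0)] using ih (x - 1) (by omega)

theorem mul_coinCount_not_visits_zero {L : ℕ} (hL : 1 ≤ L) (n x : ℕ) (hx : x ≤ L) :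
    n * (coinCount n fun ω => ¬ Visits L n x 0 ω : ℤ) ≤
      ((L : ℤ) ^ 2 - (L - x) ^ 2) * 2 ^ n := by
  induction n generalizing x with
  | zero =>
    have : (x : ℤ) ≤ L := mod_cast hx
    simp only [Nat.cast_zero, zero_mul, pow_zero, mul_one]
    nlinarith [Int.natCast_nonneg x]
  | succ n ih =>
    rcases eq_or_ne x 0 with rfl | hx0
    · simp [visits_self, coinCount]
    rcases eq_or_ne x L with rfl | hxL
    · refine coinCount_drift (a := (x : ℤ) ^ 2 - 1) (b := (x : ℤ) ^ 2 - 1) ?_ ?_ (by simp; linarith)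
      all_goals
        simp only [visits_consCoin, hx0, false_or, reflStep_self hL]
        simpa [Nat.cast_pred hL] using ih (x - 1) (by omega)
    · refine coinCount_drift (a := (L : ℤ) ^ 2 - (L - (x + 1)) ^ 2)
        (b := (L : ℤ) ^ 2 - (L - (x - 1)) ^ 2) ?_ ?_ (by linarith)
      · simp only [visits_consCoin, hx0, false_or, reflStep_true hx0 hxL]
        simpa using ih (x + 1) (by omega)
      · simp only [visits_consCoin, hx0, false_or, reflStep_false hx0 hxL]
        simpa [Nat.cast_pred (Nat.pos_of_ne_zero hx0)] using ih (x - 1) (by omega)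

theorem mul_coinCount_not_visits_both {L : ℕ} (hL : 1 ≤ L) (n x : ℕ) (hx : x ≤ L) :
    n * (coinCount n fun ω => ¬ (Visits L n x 0 ω ∧ Visits L n x L ω) : ℤ) ≤
      (x * (L - x) + (L : ℤ) ^ 2) * 2 ^ n := by
  induction n generalizing x with
  | zero =>
    have : (0 : ℤ) ≤ L - x := sub_nonneg.mpr (mod_cast hx)
    simp only [Nat.cast_zero, zero_mul, pow_zero, mul_one]
    positivity
  | succ n ih =>
    rcases eq_or_ne x 0 with rfl | hx0
    · simpa [visits_self] using mul_coinCount_not_visits_top hL (n + 1) 0 hx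
    rcases eq_or_ne x L with rfl | hxL
    · simpa [visits_self] using mul_coinCount_not_visits_zero hL (n + 1) x hx
    refine coinCount_drift (a := (x + 1) * (L - (x + 1)) + (L : ℤ) ^ 2)
      (b := (x - 1) * (L - (x - 1)) + (L : ℤ) ^ 2) ?_ ?_ (by linarith)
    · simp only [visits_consCoin, hx0, hxL, false_or, reflStep_true hx0 hxL]
      simpa using ih (x + 1) (by omega)
    · simp only [visits_consCoin, hx0, hxL, false_or, reflStep_false hx0 hxL]
      simpa [Nat.cast_pred (Nat.pos_of_ne_zero hx0)] using ih (x - 1) (by omega)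

/-- For `L ≥ 1`, a start `x₀ ∈ {0,…,L}`, and a horizon `n ≥ 4L²`, the
probability over a uniformly random coin sequence `ω ∈ {0,1}^n` that the
reflected simple random walk started at `x₀` hits both `0` and `L` within `n`
steps is at least `1/2`. -/
theorem reflected_walk_hits_both_ends (L : ℕ) (hL : 1 ≤ L) (x₀ : ℕ)
    (hx : x₀ ≤ L) (n : ℕ) (hn : 4 * L ^ 2 ≤ n) :
    (1 / 2 : ℝ) ≤
      (Finset.univ.filter (fun ω : Fin n → Bool =>
          (∃ t ≤ n,
            reflWalk L x₀ (fun s => if h : s < n then ω ⟨s, h⟩ else false) t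
              = 0) ∧
          (∃ s ≤ n,
            reflWalk L x₀ (fun s' => if h : s' < n then ω ⟨s', h⟩ else false) s
              = L))).card / 2 ^ n := by
  have key := mul_coinCount_not_visits_both hL n x₀ hx
  have hsum := coinCount_add_not n fun ω => Visits L n x₀ 0 ω ∧ Visits L n x₀ L ω
  set good := coinCount n fun ω => Visits L n x₀ 0 ω ∧ Visits L n x₀ L ω with hgood
  set bad := coinCount n fun ω => ¬ (Visits L n x₀ 0 ω ∧ Visits L n x₀ L ω)
  have hpot : (x₀ * (L - x₀) + (L : ℤ) ^ 2) ≤ 2 * L ^ 2 := by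
    nlinarith [sq_nonneg ((L : ℤ) - x₀), mul_nonneg (Int.natCast_nonneg L) (Int.natCast_nonneg x₀),
      (mod_cast hx : (x₀ : ℤ) ≤ L)]
  have hn' : (4 * (L : ℤ) ^ 2) * bad ≤ n * bad := by
    gcongr
    exact_mod_cast hn
  have hbound : (2 * (L : ℤ) ^ 2) * (2 * bad) ≤ (2 * (L : ℤ) ^ 2) * 2 ^ n := by
    have := mul_le_mul_of_nonneg_right hpot (by positivity : (0 : ℤ) ≤ 2 ^ n)
    linarith
  have hbad : 2 * bad ≤ 2 ^ n := by
    exact_mod_cast le_of_mul_le_mul_left hbound (by positivity)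
  have hhalf : 2 ^ n ≤ 2 * good := by omega
  rw [le_div_iff₀ (by positivity)]
  have hcast : (2 : ℝ) ^ n ≤ 2 * good := mod_cast hhalf
  have : (1 / 2 : ℝ) * 2 ^ n ≤ good := by linarith
  refine this.trans_eq ?_
  rw [hgood, coinCount]
  congr!
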